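/- arXiv:2402.14620 — 2 statements merged into one kernel-verified Lean document; each statement's English description precedes it below -/
import Mathlib

section
/- There exists an absolute constant C such that, for all reals α, δ ∈ (0,1) and all nonnegative integers d, m, n, r satisfying r ≥ 2, α < 1/(r² + r), and 1 ≤ m ≤ (1−δ)·C(n,2), the probability that the uniformly random graph G(n,m) does not belong to CORE_d^r(α) is at most (Cr²/α)·( ((d+1)/δ + r)·√(n/m) + (n/m)^{1/4} ). -/
open scoped Classical
open Filter

noncomputable section

/-- The possible edges of a graph on vertex set `Fin n`. -/
abbrev EdgeType (n : ℕ) := {e : Sym2 (Fin n) // ¬ e.IsDiag}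

/-- A graph on vertex set `Fin n`, identified with its edge set. -/
abbrev EdgeSetGraph (n : ℕ) := Finset (EdgeType n)

/-- The size of the `r`-cut given by `φ` in `G`. -/
def cutSize {n r : ℕ} (φ : Fin n → Fin r) (G : EdgeSetGraph n) : ℕ :=
  (G.filter fun e => ¬ (Sym2.map φ (e : Sym2 (Fin n))).IsDiag).card

/-- The maximum size of an `r`-cut of `G`. -/
def maxCut (n r : ℕ) (G : EdgeSetGraph n) : ℕ :=
  Finset.univ.sup fun φ : Fin n → Fin r => cutSize φ G

/-- The deficit of the `r`-cut `φ` in `G`. -/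
def deficit {n : ℕ} (r : ℕ) (φ : Fin n → Fin r) (G : EdgeSetGraph n) : ℕ :=
  maxCut n r G - cutSize φ G

/-- `u` and `v` are `(d,r)`-equivalent in `G`. -/
def EqvV {n : ℕ} (d r : ℕ) (G : EdgeSetGraph n) (u v : Fin n) : Prop :=
  ∀ φ : Fin n → Fin r, deficit r φ G ≤ d → φ u = φ v

/-- The `(d,r)`-component of `v` in `G`. -/
def component {n : ℕ} (d r : ℕ) (G : EdgeSetGraph n) (v : Fin n) : Finset (Fin n) :=
  Finset.univ.filter fun u => EqvV d r G v u

/-- The family of `(d,r)`-components of `G` having more than `n/(r+1)` vertices. -/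
def coreSets {n : ℕ} (d r : ℕ) (G : EdgeSetGraph n) : Finset (Finset (Fin n)) :=
  (Finset.univ.image fun v : Fin n => component d r G v).filter
    fun S => ((n : ℝ) / (r + 1)) < (S.card : ℝ)

/-- `G` has a `(d,r)`-core: its `r` largest `(d,r)`-components each have more than `n/(r+1)`
vertices, i.e. exactly `r` components exceed `n/(r+1)`. -/
def HasCore {n : ℕ} (d r : ℕ) (G : EdgeSetGraph n) : Prop := (coreSets d r G).card = r

/-- `G ∈ CORE_d^r(α)`: `G` has a `(d,r)`-core whose each component has at least `n/r - αn`
vertices. -/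
def InCORE {n : ℕ} (d r : ℕ) (α : ℝ) (G : EdgeSetGraph n) : Prop :=
  HasCore d r G ∧ ∀ S ∈ coreSets d r G, (n : ℝ) / r - α * n ≤ (S.card : ℝ)

/-- Probability of the event `A` under the uniform random graph `G(n,m)`. -/
def prGnm (n m : ℕ) (A : EdgeSetGraph n → Prop) : ℝ :=
  ((Finset.univ.filter fun G : EdgeSetGraph n => G.card = m ∧ A G).card : ℝ) /
    ((Finset.univ.filter fun G : EdgeSetGraph n => G.card = m).card : ℝ)

/-- The average of `F` over the `m`-element subsets of `E`. -/
def uniformAvg {E : Type*} [Fintype E] (m : ℕ) (F : Finset E → ℝ) : ℝ :=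
  (∑ G ∈ Finset.powersetCard m Finset.univ, F G) / ((Fintype.card E).choose m : ℝ)

section UniformAvg

variable {E : Type*} [Fintype E]

theorem uniformAvg_mono {m : ℕ} {F F' : Finset E → ℝ}
    (h : ∀ G : Finset E, G.card = m → F G ≤ F' G) : uniformAvg m F ≤ uniformAvg m F' := by
  unfold uniformAvg
  gcongr with G hG
  exact h G (Finset.mem_powersetCard.1 hG).2

theorem uniformAvg_add (m : ℕ) (F F' : Finset E → ℝ) :
    uniformAvg m (fun G => F G + F' G) = uniformAvg m F + uniformAvg m F' := by
  simp only [uniformAvg, Finset.sum_add_distrib, add_div]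

theorem uniformAvg_const_mul (m : ℕ) (c : ℝ) (F : Finset E → ℝ) :
    uniformAvg m (fun G => c * F G) = c * uniformAvg m F := by
  simp only [uniformAvg, ← Finset.mul_sum, mul_div_assoc]

theorem uniformAvg_const {m : ℕ} (hm : m ≤ Fintype.card E) (c : ℝ) :
    uniformAvg m (fun _ : Finset E => c) = c := by
  have : ((Fintype.card E).choose m : ℝ) ≠ 0 := by
    exact_mod_cast (Nat.choose_pos hm).ne'
  simp only [uniformAvg, Finset.sum_const, Finset.card_powersetCard, Finset.card_univ,
    nsmul_eq_mul]
  field_simp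

theorem uniformAvg_sum {ι : Type*} (m : ℕ) (s : Finset ι) (F : ι → Finset E → ℝ) :
    uniformAvg m (fun G => ∑ i ∈ s, F i G) = ∑ i ∈ s, uniformAvg m (F i) := by
  simp only [uniformAvg, ← Finset.sum_div]
  rw [Finset.sum_comm]

theorem choose_mul_pow_le {m N : ℕ} (h : m ≤ N) (k : ℕ) :
    m.choose k * N ^ k ≤ N.choose k * m ^ k := by
  have key : m.descFactorial k * N ^ k ≤ N.descFactorial k * m ^ k := by
    induction k with
    | zero => simp
    | succ k ih =>
      rw [Nat.descFactorial_succ, Nat.descFactorial_succ, pow_succ, pow_succ]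
      have h1 : (m - k) * N ≤ (N - k) * m := by
        rw [Nat.sub_mul, Nat.sub_mul, mul_comm N m]
        exact Nat.sub_le_sub_left (Nat.mul_le_mul_left k h) _
      calc (m - k) * m.descFactorial k * (N ^ k * N)
          = (m.descFactorial k * N ^ k) * ((m - k) * N) := by ring
        _ ≤ (N.descFactorial k * m ^ k) * ((N - k) * m) := Nat.mul_le_mul ih h1
        _ = _ := by ring
  rw [Nat.descFactorial_eq_factorial_mul_choose, Nat.descFactorial_eq_factorial_mul_choose,
    mul_assoc, mul_assoc] at key
  exact Nat.le_of_mul_le_mul_left key (Nat.factorial_pos k)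

variable [DecidableEq E]

theorem card_filter_superset_le {m : ℕ} (hm : m ≤ Fintype.card E) (T : Finset E) :
    (((Finset.powersetCard m (Finset.univ : Finset E)).filter fun G => T ⊆ G).card : ℝ) ≤
      ((Fintype.card E).choose m : ℝ) * ((m : ℝ) / Fintype.card E) ^ T.card := by
  set N := Fintype.card E with hN
  have hTN : T.card ≤ N := Finset.card_le_univ T
  rcases lt_or_ge m T.card with h | h
  · rw [Finset.filter_false_of_mem]
    · simp only [Finset.card_empty, Nat.cast_zero]
      positivity
    · intro G hG hT
      have := Finset.card_le_card hT
      rw [(Finset.mem_powersetCard.1 hG).2] at this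
      omega
  have hcard : ((Finset.powersetCard m (Finset.univ : Finset E)).filter fun G => T ⊆ G).card ≤
      (N - T.card).choose (m - T.card) := by
    rw [hN, ← Finset.card_compl T, ← Finset.card_powersetCard]
    refine Finset.card_le_card_of_injOn (fun G => G \ T) ?_ ?_
    · intro G hG
      simp only [Finset.coe_filter, Finset.mem_powersetCard, Set.mem_ofPred_eq] at hG
      simp only [Finset.mem_coe, Finset.mem_powersetCard]
      refine ⟨fun x hx => ?_, ?_⟩
      · simp only [Finset.mem_sdiff] at hx
        simpa using hx.2
      · rw [Finset.card_sdiff_of_subset hG.2, hG.1.2]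
    · intro G hG G' hG' heq
      simp only [Finset.coe_filter, Set.mem_ofPred_eq] at hG hG'
      have : G \ T = G' \ T := heq
      rw [← Finset.sdiff_union_of_subset hG.2, this, Finset.sdiff_union_of_subset hG'.2]
  have hid := Nat.choose_mul (n := N) (k := m) (s := T.card) h
  have hle := choose_mul_pow_le hm T.card
  have hpos : 0 < (N.choose T.card : ℝ) := by exact_mod_cast Nat.choose_pos hTN
  rcases Nat.eq_zero_or_pos N with h0 | h0
  · have hT0 : T.card = 0 := by omega
    rw [hT0] at hcard ⊢
    simpa using (Nat.cast_le (α := ℝ)).2 hcard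
  have hNpos : (0 : ℝ) < N := by exact_mod_cast h0
  rw [div_pow, ← mul_div_assoc, le_div_iff₀ (by positivity)]
  have hid' : (N.choose m : ℝ) * m.choose T.card =
      N.choose T.card * (N - T.card).choose (m - T.card) := by exact_mod_cast hid
  have hle' : (m.choose T.card : ℝ) * (N : ℝ) ^ T.card ≤ N.choose T.card * (m : ℝ) ^ T.card := by
    exact_mod_cast hle
  have hcard' : (((Finset.powersetCard m (Finset.univ : Finset E)).filter
      fun G => T ⊆ G).card : ℝ) ≤ ((N - T.card).choose (m - T.card) : ℝ) := by
    exact_mod_cast hcard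
  refine le_of_mul_le_mul_left ?_ hpos
  calc (N.choose T.card : ℝ) * ((((Finset.powersetCard m (Finset.univ : Finset E)).filter
          fun G => T ⊆ G).card : ℝ) * (N : ℝ) ^ T.card)
      ≤ (N.choose T.card : ℝ) * (((N - T.card).choose (m - T.card) : ℝ) * (N : ℝ) ^ T.card) := by
        gcongr
    _ = (N.choose m : ℝ) * (m.choose T.card * (N : ℝ) ^ T.card) := by
        rw [← mul_assoc, ← hid', mul_assoc]
    _ ≤ (N.choose m : ℝ) * (N.choose T.card * (m : ℝ) ^ T.card) := by gcongr
    _ = _ := by ring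

/-- The moment generating function of the hypergeometric distribution is dominated by that of
the binomial distribution. -/
theorem uniformAvg_pow_card_inter_le {m : ℕ} (hm : m ≤ Fintype.card E) (S : Finset E) {t : ℝ}
    (ht : 0 ≤ t) :
    uniformAvg m (fun G => (t + 1) ^ (G ∩ S).card) ≤
      (t * ((m : ℝ) / Fintype.card E) + 1) ^ S.card := by
  have hC : (0 : ℝ) < ((Fintype.card E).choose m : ℝ) := by
    exact_mod_cast Nat.choose_pos hm
  have hexp : ∀ G : Finset E, (t + 1) ^ (G ∩ S).card =
      ∑ T ∈ S.powerset, if T ⊆ G then t ^ T.card else 0 := by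
    intro G
    rw [← Finset.sum_pow_mul_eq_add_pow, ← Finset.sum_filter]
    refine Finset.sum_congr ?_ fun T _ => by simp
    ext T
    simp only [Finset.mem_powerset, Finset.mem_filter, Finset.subset_inter_iff]
    tauto
  rw [uniformAvg, div_le_iff₀ hC]
  simp only [hexp]
  rw [Finset.sum_comm, ← Finset.sum_pow_mul_eq_add_pow, Finset.sum_mul]
  refine Finset.sum_le_sum fun T _ => ?_
  rw [← Finset.sum_filter, Finset.sum_const, nsmul_eq_mul]
  calc _ ≤ (((Fintype.card E).choose m : ℝ) * ((m : ℝ) / Fintype.card E) ^ T.card) *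
        t ^ T.card := by
        gcongr
        exact card_filter_superset_le hm T
    _ = _ := by rw [one_pow, mul_pow]; ring

/-- The deviation of `|G ∩ S|` from its mean over the `|G|`-element subsets of `E`. -/
def discrepancy (S G : Finset E) : ℝ :=
  ((G ∩ S).card : ℝ) - (G.card : ℝ) / Fintype.card E * S.card

theorem discrepancy_compl {G : Finset E} (hG : G.card ≤ Fintype.card E) (S : Finset E) :
    discrepancy Sᶜ G = -discrepancy S G := by
  unfold discrepancy
  have h1 : ((G ∩ Sᶜ).card : ℝ) = G.card - (G ∩ S).card := by
    have := Finset.card_inter_add_card_sdiff G S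
    rw [← Finset.sdiff_eq_inter_compl, ← this]
    push_cast
    ring
  have h2 : ((Sᶜ.card : ℕ) : ℝ) = Fintype.card E - S.card := by
    rw [Finset.card_compl, Nat.cast_sub (Finset.card_le_univ S)]
  rw [h1, h2]
  rcases Nat.eq_zero_or_pos (Fintype.card E) with h0 | h0
  · have : G.card = 0 := by omega
    simp [this, h0]
  · have : (Fintype.card E : ℝ) ≠ 0 := by exact_mod_cast h0.ne'
    field_simp
    ring

theorem uniformAvg_exp_discrepancy_le {m : ℕ} (hm : m ≤ Fintype.card E) (S : Finset E) {l : ℝ}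
    (hl : 0 ≤ l) (hl1 : l ≤ 1) :
    uniformAvg m (fun G => Real.exp (l * discrepancy S G)) ≤ Real.exp (m * l ^ 2) := by
  set q : ℝ := (m : ℝ) / Fintype.card E with hq
  have hq0 : 0 ≤ q := by positivity
  have ht : 0 ≤ Real.exp l - 1 := by linarith [Real.one_le_exp hl]
  have h1 := uniformAvg_pow_card_inter_le hm S ht
  have hμ : q * S.card ≤ m := by
    rcases Nat.eq_zero_or_pos (Fintype.card E) with h0 | h0
    · simp [hq, h0]
    · have h0' : (0 : ℝ) < Fintype.card E := by exact_mod_cast h0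
      have : (S.card : ℝ) ≤ Fintype.card E := by exact_mod_cast Finset.card_le_univ S
      calc q * S.card ≤ q * Fintype.card E := by gcongr
        _ = m := by rw [hq]; field_simp
  have h2 : uniformAvg m (fun G : Finset E => Real.exp (l * discrepancy S G)) =
      Real.exp (-(l * (q * S.card))) *
        uniformAvg m (fun G => ((Real.exp l - 1) + 1) ^ (G ∩ S).card) := by
    rw [← uniformAvg_const_mul]
    unfold uniformAvg
    congr 1
    refine Finset.sum_congr rfl fun G hG => ?_
    beta_reduce
    rw [sub_add_cancel, ← Real.exp_nat_mul, ← Real.exp_add, discrepancy,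
      (Finset.mem_powersetCard.1 hG).2]
    congr 1
    ring
  have h3 : ((Real.exp l - 1) * q + 1) ^ S.card ≤
      Real.exp ((Real.exp l - 1) * (q * S.card)) := by
    calc ((Real.exp l - 1) * q + 1) ^ S.card ≤ (Real.exp ((Real.exp l - 1) * q)) ^ S.card := by
          gcongr
          exact Real.add_one_le_exp _
      _ = _ := by rw [← Real.exp_nat_mul]; congr 1; ring
  have h4 : Real.exp l - 1 - l ≤ l ^ 2 :=
    (le_abs_self _).trans (Real.abs_exp_sub_one_sub_id_le (by rwa [abs_of_nonneg hl]))
  rw [h2]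
  calc _ ≤ Real.exp (-(l * (q * S.card))) * Real.exp ((Real.exp l - 1) * (q * S.card)) := by
        gcongr
        exact h1.trans h3
    _ = Real.exp ((Real.exp l - 1 - l) * (q * S.card)) := by
        rw [← Real.exp_add]; congr 1; ring
    _ ≤ Real.exp (l ^ 2 * m) := by
        gcongr
    _ = _ := by rw [mul_comm]

/-- A family of at most `2 ^ n` subsets of `E` has expected maximal discrepancy `O(√(nm))`. -/
theorem exists_discrepancy_bound {ι : Type*} [Fintype ι] {n m : ℕ} (hn : 1 ≤ n) (hnm : n ≤ m)
    (hm : m ≤ Fintype.card E) (hι : Fintype.card ι ≤ 2 ^ n) (S : ι → Finset E) :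
    ∃ D : Finset E → ℝ, (∀ G, G.card = m → ∀ i, |discrepancy (S i) G| ≤ D G) ∧
      uniformAvg m D ≤ 3 * (m * Real.sqrt (n / m)) := by
  have hn0 : (0 : ℝ) < n := by exact_mod_cast hn
  have hm0 : (0 : ℝ) < m := by exact_mod_cast (by omega : 0 < m)
  set l : ℝ := Real.sqrt (n / m) with hl
  have hlpos : 0 < l := Real.sqrt_pos.2 (by positivity)
  have hlsq : m * l ^ 2 = n := by
    rw [hl, Real.sq_sqrt (by positivity)]; field_simp
  have hl1 : l ≤ 1 := by
    rw [hl, Real.sqrt_le_iff, one_pow, div_le_one hm0]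
    refine ⟨zero_le_one, ?_⟩
    exact_mod_cast hnm
  set K : ℝ := 3 * n with hK
  refine ⟨fun G => l⁻¹ * ((K - 1) + Real.exp (-K) * ∑ i, (Real.exp (l * discrepancy (S i) G) +
    Real.exp (l * discrepancy (S i)ᶜ G))), ?_, ?_⟩
  · intro G hG i
    beta_reduce
    rw [inv_mul_eq_div, le_div_iff₀ hlpos]
    have hc := discrepancy_compl (hG ▸ hm) (S i)
    have hsum : Real.exp (l * |discrepancy (S i) G|) ≤
        ∑ i, (Real.exp (l * discrepancy (S i) G) + Real.exp (l * discrepancy (S i)ᶜ G)) := by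
      refine le_trans ?_ (Finset.single_le_sum (f := fun i => Real.exp (l * discrepancy (S i) G) +
        Real.exp (l * discrepancy (S i)ᶜ G)) (fun j _ => by positivity) (Finset.mem_univ i))
      simp only [hc]
      rcases abs_choice (discrepancy (S i) G) with h | h <;> rw [h]
      · linarith [Real.exp_pos (l * -discrepancy (S i) G)]
      · linarith [Real.exp_pos (l * discrepancy (S i) G)]
    have h1 := Real.add_one_le_exp (l * |discrepancy (S i) G| - K)
    have h2 : Real.exp (l * |discrepancy (S i) G| - K) =
        Real.exp (-K) * Real.exp (l * |discrepancy (S i) G|) := by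
      rw [← Real.exp_add]; congr 1; ring
    have h3 := mul_le_mul_of_nonneg_left hsum (Real.exp_pos (-K)).le
    linarith
  · rw [uniformAvg_const_mul, uniformAvg_add, uniformAvg_const hm, uniformAvg_const_mul,
      uniformAvg_sum]
    have h1 : ∑ i, uniformAvg m (fun G => Real.exp (l * discrepancy (S i) G) +
        Real.exp (l * discrepancy (S i)ᶜ G)) ≤ Real.exp K := by
      calc _ ≤ ∑ _i : ι, (Real.exp n + Real.exp n) := by
            refine Finset.sum_le_sum fun i _ => ?_
            rw [uniformAvg_add, ← hlsq]
            exact add_le_add (uniformAvg_exp_discrepancy_le hm _ hlpos.le hl1)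
              (uniformAvg_exp_discrepancy_le hm _ hlpos.le hl1)
        _ = Fintype.card ι * (2 * Real.exp n) := by
            rw [Finset.sum_const, Finset.card_univ, nsmul_eq_mul]; ring
        _ ≤ (2 : ℝ) ^ n * (2 ^ n * Real.exp n) := by
            gcongr
            · exact_mod_cast hι
            · exact le_self_pow₀ (by norm_num) (by omega)
        _ ≤ (Real.exp 1) ^ n * ((Real.exp 1) ^ n * Real.exp n) := by
            have : (2 : ℝ) ≤ Real.exp 1 := by
              have := Real.add_one_le_exp 1
              linarith
            gcongr
        _ = Real.exp K := by
            rw [← Real.exp_nat_mul, ← Real.exp_add, ← Real.exp_add]; congr 1; rw [hK]; ring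
    have h2 : Real.exp (-K) * ∑ i, uniformAvg m (fun G => Real.exp (l * discrepancy (S i) G) +
        Real.exp (l * discrepancy (S i)ᶜ G)) ≤ 1 := by
      calc _ ≤ Real.exp (-K) * Real.exp K := by gcongr
        _ = 1 := by rw [← Real.exp_add]; simp
    calc _ ≤ l⁻¹ * (K - 1 + 1) := by gcongr
      _ = 3 * (m * l) := by
        rw [hK, ← hlsq]; field_simp; ring

/-- Adding a uniformly random new element to a uniformly random `m`-subset gives a uniformly
random `(m+1)`-subset with a uniformly random marked element. -/
theorem sum_powersetCard_insert (m : ℕ) (F : Finset E → E → ℝ) :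
    ∑ G ∈ Finset.powersetCard m (Finset.univ : Finset E), ∑ e ∈ Gᶜ, F (insert e G) e =
      ∑ H ∈ Finset.powersetCard (m + 1) (Finset.univ : Finset E), ∑ e ∈ H, F H e := by
  rw [Finset.sum_sigma', Finset.sum_sigma']
  refine Finset.sum_bij' (fun x _ => ⟨insert x.2 x.1, x.2⟩) (fun y _ => ⟨y.1.erase y.2, y.2⟩)
    ?_ ?_ ?_ ?_ ?_
  · rintro ⟨G, e⟩ h
    simp only [Finset.mem_sigma, Finset.mem_powersetCard_univ, Finset.mem_compl] at h ⊢
    exact ⟨by rw [Finset.card_insert_of_notMem h.2, h.1], Finset.mem_insert_self _ _⟩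
  · rintro ⟨H, e⟩ h
    simp only [Finset.mem_sigma, Finset.mem_powersetCard_univ, Finset.mem_compl] at h ⊢
    exact ⟨by rw [Finset.card_erase_of_mem h.2, h.1]; rfl, Finset.notMem_erase _ _⟩
  · rintro ⟨G, e⟩ h
    simp only [Finset.mem_sigma, Finset.mem_compl] at h
    simp [Finset.erase_insert h.2]
  · rintro ⟨H, e⟩ h
    simp only [Finset.mem_sigma] at h
    simp [Finset.insert_erase h.2]
  · rintro ⟨G, e⟩ h
    rfl

theorem uniformAvg_insert {m : ℕ} (hm : m < Fintype.card E) (F : Finset E → E → ℝ) :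
    uniformAvg m (fun G => (∑ e ∈ Gᶜ, F (insert e G) e) / (Fintype.card E - m)) =
      uniformAvg (m + 1) (fun H => (∑ e ∈ H, F H e) / (m + 1)) := by
  have h1 := Nat.choose_succ_right_eq (Fintype.card E) m
  have h2 : ((Fintype.card E).choose (m + 1) : ℝ) * (m + 1) =
      (Fintype.card E).choose m * (Fintype.card E - m) := by
    rw [← Nat.cast_sub hm.le]
    exact_mod_cast h1
  simp only [uniformAvg, ← Finset.sum_div]
  rw [sum_powersetCard_insert, div_div, div_div, mul_comm ((Fintype.card E : ℝ) - m), ← h2,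
    mul_comm ((m : ℝ) + 1)]

end UniformAvg

section Crossing

variable {n : ℕ}

/-- The pairs of vertices that `f` separates. -/
def crossing {κ : Type*} (f : Fin n → κ) : Finset (EdgeType n) :=
  Finset.univ.filter fun e => ¬ (Sym2.map f (e : Sym2 (Fin n))).IsDiag

theorem cutSize_eq_card_inter {r : ℕ} (φ : Fin n → Fin r) (G : EdgeSetGraph n) :
    cutSize φ G = (G ∩ crossing φ).card := by
  rw [cutSize, ← Finset.card_image_of_injective (G ∩ crossing φ) Subtype.val_injective]
  congr 1
  ext e
  simp only [crossing, Finset.mem_filter, Finset.mem_image, Finset.mem_inter, Finset.mem_univ,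
    true_and, Finset.bind_def, Finset.pure_def, Finset.mem_sup, Finset.mem_singleton]
  constructor
  · rintro ⟨⟨a, ha, rfl⟩, h⟩
    exact ⟨a, ⟨ha, h⟩, rfl⟩
  · rintro ⟨a, ⟨ha, h⟩, rfl⟩
    exact ⟨⟨a, ha, rfl⟩, h⟩

theorem card_edgeType : Fintype.card (EdgeType n) = n.choose 2 := by
  rw [Sym2.card_subtype_not_diag, Fintype.card_fin]

theorem card_filter_apply_eq {κ : Type*} [Fintype κ] {ι : Type*} [Fintype ι] [DecidableEq ι] {a b : ι}
    (hab : a ≠ b) :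
    (Finset.univ.filter fun c : ι → κ => c a = c b).card * Fintype.card κ =
      Fintype.card (ι → κ) := by
  rw [← Finset.card_univ (α := κ), ← Finset.card_product, ← Finset.card_univ (α := ι → κ)]
  refine Finset.card_bij' (fun x _ => Function.update x.1 a x.2)
    (fun c _ => (Function.update c a (c b), c a)) ?_ ?_ ?_ ?_
  · intro x _
    exact Finset.mem_univ _
  · intro c _
    simp [hab.symm]
  · rintro ⟨c, k⟩ h
    simp only [Finset.mem_product, Finset.mem_filter, Finset.mem_univ, true_and, and_true] at h
    simp [hab.symm, ← h]
  · intro c _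
    simp

theorem card_filter_apply_ne {κ : Type*} [Fintype κ] {ι : Type*} [Fintype ι] [DecidableEq ι] {a b : ι}
    (hab : a ≠ b) :
    ((Finset.univ.filter fun c : ι → κ => ¬ c a = c b).card : ℝ) * Fintype.card κ =
      (Fintype.card κ - 1) * Fintype.card (ι → κ) := by
  have h1 := card_filter_apply_eq (κ := κ) hab
  have h2 := Finset.card_filter_add_card_filter_not (s := (Finset.univ : Finset (ι → κ)))
    (fun c : ι → κ => c a = c b)
  rw [Finset.card_univ] at h2
  have h1' : ((Finset.univ.filter fun c : ι → κ => c a = c b).card : ℝ) * Fintype.card κ =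
      Fintype.card (ι → κ) := by exact_mod_cast h1
  have h2' : ((Finset.univ.filter fun c : ι → κ => c a = c b).card : ℝ) +
      (Finset.univ.filter fun c : ι → κ => ¬ c a = c b).card = Fintype.card (ι → κ) := by
    exact_mod_cast h2
  rw [← h2'] at h1' ⊢
  linear_combination -h1'

theorem card_inter_crossing {κ : Type*} (f : Fin n → κ) (G : EdgeSetGraph n) :
    ((G ∩ crossing f).card : ℝ) =
      ∑ e ∈ G, if (Sym2.map f (e : Sym2 (Fin n))).IsDiag then (0 : ℝ) else 1 := by
  have : G ∩ crossing f =
      Finset.filter (fun e : EdgeType n => ¬ (Sym2.map f (e : Sym2 (Fin n))).IsDiag) G := by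
    ext e; simp [crossing]
  rw [this, Finset.card_filter]
  push_cast
  exact Finset.sum_congr rfl fun e _ => by split_ifs <;> simp_all

theorem sum_card_inter_crossing_comp {ι κ : Type*} [Fintype ι] [DecidableEq ι] [Fintype κ] (f : Fin n → ι)
    (G : EdgeSetGraph n) :
    ∑ c : ι → κ, ((G ∩ crossing (c ∘ f)).card : ℝ) * Fintype.card κ =
      (Fintype.card κ - 1) * Fintype.card (ι → κ) * (G ∩ crossing f).card := by
  rw [← Finset.sum_mul]
  simp only [card_inter_crossing]
  rw [Finset.sum_comm, Finset.sum_mul, Finset.mul_sum]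
  refine Finset.sum_congr rfl fun e _ => ?_
  obtain ⟨e, he⟩ := e
  induction e using Sym2.ind with
  | _ u v =>
    simp only [Sym2.map_mk, Sym2.mk_isDiag_iff, Function.comp]
    by_cases h : f u = f v
    · simp [h]
    · rw [if_neg h, mul_one, ← card_filter_apply_ne h, Finset.card_filter]
      push_cast
      congr 1
      exact Finset.sum_congr rfl fun c _ => by split_ifs <;> simp_all

/-- Discrepancy bounds for bipartitions give discrepancy bounds for all partitions. -/
theorem abs_discrepancy_crossing_le {G : EdgeSetGraph n} {D : ℝ}
    (hD : ∀ χ : Fin n → Bool, |discrepancy (crossing χ) G| ≤ D) {ι : Type*} [Fintype ι]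
    (f : Fin n → ι) : |discrepancy (crossing f) G| ≤ 2 * D := by
  have h1 := sum_card_inter_crossing_comp (κ := Bool) f G
  have h2 := sum_card_inter_crossing_comp (κ := Bool) f Finset.univ
  simp only [Finset.univ_inter, Fintype.card_bool, ← Finset.sum_mul] at h1 h2
  set M : ℝ := (Fintype.card (ι → Bool) : ℝ) with hM
  have hMpos : 0 < M := by
    rw [hM]; exact_mod_cast Fintype.card_pos
  have h3 : M * discrepancy (crossing f) G =
      2 * ∑ c : ι → Bool, discrepancy (crossing (c ∘ f)) G := by
    simp only [discrepancy, Finset.sum_sub_distrib, ← Finset.mul_sum]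
    push_cast at h1 h2
    linear_combination -h1 + (G.card : ℝ) / Fintype.card (EdgeType n) * h2
  have h4 : |∑ c : ι → Bool, discrepancy (crossing (c ∘ f)) G| ≤ M * D := by
    calc _ ≤ ∑ c : ι → Bool, |discrepancy (crossing (c ∘ f)) G| := Finset.abs_sum_le_sum_abs _ _
      _ ≤ ∑ _c : ι → Bool, D := Finset.sum_le_sum fun c _ => hD _
      _ = M * D := by rw [Finset.sum_const, Finset.card_univ, nsmul_eq_mul]
  refine le_of_mul_le_mul_left ?_ hMpos
  calc M * |discrepancy (crossing f) G| = |M * discrepancy (crossing f) G| := by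
        rw [abs_mul, abs_of_pos hMpos]
    _ = 2 * |∑ c : ι → Bool, discrepancy (crossing (c ∘ f)) G| := by
        rw [h3, abs_mul, abs_two]
    _ ≤ M * (2 * D) := by linarith

theorem le_maxCut {r : ℕ} (φ : Fin n → Fin r) (G : EdgeSetGraph n) :
    cutSize φ G ≤ maxCut n r G :=
  Finset.le_sup (f := fun φ : Fin n → Fin r => cutSize φ G) (Finset.mem_univ φ)

theorem exists_cutSize_eq_maxCut {r : ℕ} (hr : 1 ≤ r) (G : EdgeSetGraph n) :
    ∃ φ : Fin n → Fin r, cutSize φ G = maxCut n r G := by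
  have : Nonempty (Fin n → Fin r) := ⟨fun _ => ⟨0, hr⟩⟩
  obtain ⟨φ, -, h⟩ := Finset.exists_mem_eq_sup Finset.univ Finset.univ_nonempty
    fun φ : Fin n → Fin r => cutSize φ G
  exact ⟨φ, h.symm⟩

theorem mul_card_le_maxCut {r : ℕ} (hr : 1 ≤ r) (G : EdgeSetGraph n) :
    (1 - 1 / (r : ℝ)) * G.card ≤ maxCut n r G := by
  have h := sum_card_inter_crossing_comp (κ := Fin r) (id : Fin n → Fin n) G
  have hid : G ∩ crossing (id : Fin n → Fin n) = G := by
    ext e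
    simpa [crossing] using fun _ => e.2
  simp only [Function.comp_id, hid, ← cutSize_eq_card_inter, ← Finset.sum_mul,
    Fintype.card_fin] at h
  have hr0 : (0 : ℝ) < r := by exact_mod_cast hr
  set M : ℝ := (Fintype.card (Fin n → Fin r) : ℝ) with hM
  have hMpos : 0 < M := by
    have : Nonempty (Fin n → Fin r) := ⟨fun _ => ⟨0, hr⟩⟩
    rw [hM]; exact_mod_cast Fintype.card_pos
  have h1 : ∑ φ : Fin n → Fin r, (cutSize φ G : ℝ) ≤ M * maxCut n r G := by
    calc _ ≤ ∑ _φ : Fin n → Fin r, (maxCut n r G : ℝ) :=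
          Finset.sum_le_sum fun φ _ => by exact_mod_cast le_maxCut φ G
      _ = _ := by rw [Finset.sum_const, Finset.card_univ, nsmul_eq_mul]
  have h2 : ((r : ℝ) - 1) * M * G.card ≤ M * maxCut n r G * r := by
    rw [← h]; gcongr
  have h3 : (1 - 1 / (r : ℝ)) * G.card = ((r : ℝ) - 1) * M * G.card / (M * r) := by
    field_simp
  rw [h3, div_le_iff₀ (by positivity)]
  linarith

/-- The number of ordered pairs of vertices which `f` does not separate. -/
theorem sum_card_fibre {ι : Type*} [DecidableEq ι] (f : Fin n → ι) :
    ∑ u : Fin n, ((Finset.univ.filter fun v => f u = f v).card : ℝ) =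
      (n : ℝ) ^ 2 - 2 * (crossing f).card := by
  have h1 : (Finset.univ.filter fun x : Fin n × Fin n => ¬ f x.1 = f x.2).card =
      2 * (crossing f).card := by
    have hmap : ∀ x ∈ (Finset.univ.filter fun x : Fin n × Fin n => ¬ f x.1 = f x.2),
        s(x.1, x.2) ∈ (crossing f).image (Subtype.val) := by
      rintro ⟨u, v⟩ hx
      simp only [Finset.mem_filter, Finset.mem_univ, true_and] at hx
      simp only [Finset.mem_image]
      refine ⟨⟨s(u, v), ?_⟩, ?_, rfl⟩
      · simp only [Sym2.mk_isDiag_iff]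
        rintro rfl
        exact hx rfl
      · simpa [crossing] using hx
    rw [Finset.card_eq_sum_card_fiberwise (f := fun x : Fin n × Fin n => s(x.1, x.2)) hmap]
    rw [← Finset.card_image_of_injective (crossing f) Subtype.val_injective, mul_comm,
      ← smul_eq_mul, ← Finset.sum_const]
    refine Finset.sum_congr rfl fun e he => ?_
    simp only [Finset.mem_image] at he
    obtain ⟨⟨e, hd⟩, hc, rfl⟩ := he
    induction e using Sym2.ind with
    | _ u v =>
      simp only [Sym2.mk_isDiag_iff] at hd
      simp only [crossing, Finset.mem_filter, Finset.mem_univ, true_and, Sym2.map_mk,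
        Sym2.mk_isDiag_iff] at hc
      rw [← Finset.card_pair (a := (u, v)) (b := (v, u)) (by simp; tauto)]
      congr 1
      ext ⟨a, b⟩
      simp only [Finset.mem_filter, Finset.mem_univ, true_and, Sym2.eq_iff, Finset.mem_insert,
        Finset.mem_singleton, Prod.mk.injEq]
      constructor
      · exact fun h => h.2
      · rintro (⟨rfl, rfl⟩ | ⟨rfl, rfl⟩)
        · exact ⟨hc, Or.inl ⟨rfl, rfl⟩⟩
        · exact ⟨fun h => hc h.symm, Or.inr ⟨rfl, rfl⟩⟩
  have h2 := Finset.card_filter_add_card_filter_not (s := (Finset.univ : Finset (Fin n × Fin n)))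
    (fun x => f x.1 = f x.2)
  rw [h1, Finset.card_univ, Fintype.card_prod, Fintype.card_fin] at h2
  have h3 : ∑ u : Fin n, (Finset.univ.filter fun v => f u = f v).card =
      (Finset.univ.filter fun x : Fin n × Fin n => f x.1 = f x.2).card := by
    simp only [Finset.card_filter]
    rw [← Finset.univ_product_univ, Finset.sum_product]
  have h4 : ((∑ u : Fin n, (Finset.univ.filter fun v => f u = f v).card : ℕ) : ℝ) +
      2 * (crossing f).card = n * n := by
    rw [h3]; exact_mod_cast h2
  push_cast at h4
  linarith

/-- The number of vertices with the colour `i`, as a real number. -/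
def partSize {r : ℕ} (φ : Fin n → Fin r) (i : Fin r) : ℝ :=
  ((Finset.univ.filter fun v => φ v = i).card : ℝ)

theorem sum_partSize {r : ℕ} (φ : Fin n → Fin r) : ∑ i, partSize φ i = n := by
  have := Finset.card_eq_sum_card_fiberwise (s := (Finset.univ : Finset (Fin n)))
    (t := (Finset.univ : Finset (Fin r))) (f := φ) (by simp)
  rw [Finset.card_univ, Fintype.card_fin] at this
  unfold partSize
  exact_mod_cast this.symm

theorem sum_comp_eq_sum_partSize_mul {r : ℕ} (φ : Fin n → Fin r) (g : Fin r → ℝ) :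
    ∑ u, g (φ u) = ∑ i, partSize φ i * g i := by
  rw [← Finset.sum_fiberwise (s := Finset.univ) (g := φ)]
  refine Finset.sum_congr rfl fun i _ => ?_
  rw [Finset.sum_congr rfl (g := fun _ => g i)
    (fun u hu => by rw [(Finset.mem_filter.1 hu).2])]
  rw [Finset.sum_const, nsmul_eq_mul, partSize]

theorem sum_partSize_sq {r : ℕ} (φ : Fin n → Fin r) :
    ∑ i, partSize φ i ^ 2 = (n : ℝ) ^ 2 - 2 * (crossing φ).card := by
  rw [← sum_card_fibre, Finset.sum_congr rfl (g := fun u => partSize φ (φ u)),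
    sum_comp_eq_sum_partSize_mul]
  · exact Finset.sum_congr rfl fun i _ => sq _
  · intro u _
    simp only [partSize, eq_comm]

theorem sum_partSize_sub_sq {r : ℕ} (hr : 1 ≤ r) (φ : Fin n → Fin r) :
    ∑ i, (partSize φ i - n / r) ^ 2 = ∑ i, partSize φ i ^ 2 - (n : ℝ) ^ 2 / r := by
  have hr0 : (r : ℝ) ≠ 0 := by exact_mod_cast (by omega : r ≠ 0)
  simp only [sub_sq, Finset.sum_add_distrib, Finset.sum_sub_distrib, ← Finset.mul_sum,
    ← Finset.sum_mul, sum_partSize, Finset.sum_const, Finset.card_univ, Fintype.card_fin,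
    nsmul_eq_mul]
  field_simp
  ring

theorem card_crossing_le {r : ℕ} (hr : 1 ≤ r) (φ : Fin n → Fin r) :
    2 * ((crossing φ).card : ℝ) ≤ (1 - 1 / r) * (n : ℝ) ^ 2 := by
  have h1 := sum_partSize_sq φ
  have h2 := sum_partSize_sub_sq hr φ
  have h3 : 0 ≤ ∑ i, (partSize φ i - n / r) ^ 2 := Finset.sum_nonneg fun i _ => sq_nonneg _
  have : (1 - 1 / (r : ℝ)) * (n : ℝ) ^ 2 = (n : ℝ) ^ 2 - (n : ℝ) ^ 2 / r := by ring
  linarith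

end Crossing

section Separable

variable {n : ℕ}

theorem mem_component {d r : ℕ} {G : EdgeSetGraph n} {u v : Fin n} :
    v ∈ component d r G u ↔ EqvV d r G u v :=
  Finset.mem_filter.trans (and_iff_right (Finset.mem_univ v))

theorem component_eq_iff {d r : ℕ} {G : EdgeSetGraph n} {u v : Fin n} :
    component d r G u = component d r G v ↔ EqvV d r G u v := by
  constructor
  · intro h
    rw [← mem_component, h, mem_component]
    exact fun _ _ => rfl
  · intro h
    ext w
    rw [mem_component, mem_component]
    exact ⟨fun h' φ hφ => (h φ hφ).symm.trans (h' φ hφ), fun h' φ hφ => (h φ hφ).trans (h' φ hφ)⟩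

/-- The pairs of vertices lying in different `(d,r)`-components. -/
def separable (d r : ℕ) (G : EdgeSetGraph n) : Finset (EdgeType n) :=
  crossing (component d r G)

theorem mem_separable {d r : ℕ} {G : EdgeSetGraph n} {e : EdgeType n} :
    e ∈ separable d r G ↔ ∃ φ : Fin n → Fin r, deficit r φ G ≤ d ∧ e ∈ crossing φ := by
  obtain ⟨e, he⟩ := e
  induction e using Sym2.ind with
  | _ u v =>
    simp only [separable, crossing, Finset.mem_filter, Finset.mem_univ, true_and, Sym2.map_mk,
      Sym2.mk_isDiag_iff, component_eq_iff, EqvV]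
    push Not
    rfl

theorem sum_card_component (d r : ℕ) (G : EdgeSetGraph n) :
    ∑ u, ((component d r G u).card : ℝ) = (n : ℝ) ^ 2 - 2 * (separable d r G).card := by
  rw [separable, ← sum_card_fibre]
  refine Finset.sum_congr rfl fun u _ => ?_
  congr 2
  ext v
  rw [mem_component, ← component_eq_iff, Finset.mem_filter]
  exact (and_iff_right (Finset.mem_univ v)).symm

theorem deficit_le_iff {d r : ℕ} {G : EdgeSetGraph n} {φ : Fin n → Fin r} :
    deficit r φ G ≤ d ↔ maxCut n r G ≤ cutSize φ G + d := by
  unfold deficit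
  omega

theorem cutSize_insert {r : ℕ} (φ : Fin n → Fin r) {G : EdgeSetGraph n} {e : EdgeType n}
    (he : e ∉ G) :
    cutSize φ (insert e G) = cutSize φ G + if e ∈ crossing φ then 1 else 0 := by
  rw [cutSize_eq_card_inter, cutSize_eq_card_inter]
  split_ifs with h
  · rw [Finset.insert_inter_of_mem h, Finset.card_insert_of_notMem]
    simp [he]
  · rw [Finset.insert_inter_of_notMem h, add_zero]

theorem mem_separable_insert {d r : ℕ} (hr : 1 ≤ r) {G : EdgeSetGraph n} {e : EdgeType n}
    (he : e ∉ G) (h : e ∈ separable (d + 1) r G) : e ∈ separable d r (insert e G) := by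
  rw [mem_separable] at h ⊢
  by_cases hmax : maxCut n r (insert e G) ≤ maxCut n r G
  · obtain ⟨φ, hφ, hc⟩ := h
    refine ⟨φ, ?_, hc⟩
    rw [deficit_le_iff] at hφ ⊢
    rw [cutSize_insert φ he, if_pos hc]
    omega
  · obtain ⟨φ, hφ⟩ := exists_cutSize_eq_maxCut hr (insert e G)
    refine ⟨φ, ?_, ?_⟩
    · rw [deficit_le_iff]
      omega
    · by_contra hc
      rw [cutSize_insert φ he, if_neg hc] at hφ
      have := le_maxCut φ G
      omega

theorem mem_crossing_of_mem_separable_zero {r : ℕ} {G : EdgeSetGraph n}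
    {e : EdgeType n} (he : e ∉ G) (h : e ∈ separable 0 r G) {φ : Fin n → Fin r}
    (hφ : cutSize φ (insert e G) = maxCut n r (insert e G)) : e ∈ crossing φ := by
  obtain ⟨ψ, hψ, hc⟩ := mem_separable.1 h
  by_contra hn
  rw [deficit_le_iff] at hψ
  have h1 := le_maxCut ψ (insert e G)
  have h2 := le_maxCut φ G
  rw [cutSize_insert ψ he, if_pos hc] at h1
  rw [cutSize_insert φ he, if_neg hn] at hφ
  omega

/-- The expected proportion of separable pairs among the non-edges of `G(n,m)`. -/
def sepOut (n d r m : ℕ) : ℝ :=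
  uniformAvg m fun G : EdgeSetGraph n =>
    ((separable d r G \ G).card : ℝ) / (Fintype.card (EdgeType n) - m)

/-- The expected proportion of separable pairs among the edges of `G(n,m)`. -/
def sepIn (n d r m : ℕ) : ℝ :=
  uniformAvg m fun G : EdgeSetGraph n => ((G ∩ separable d r G).card : ℝ) / m

theorem card_sdiff_eq_sum (S G : Finset (EdgeType n)) :
    ((S \ G).card : ℝ) = ∑ e ∈ Gᶜ, if e ∈ S then 1 else 0 := by
  rw [← Finset.sum_filter, Finset.sum_const, nsmul_eq_mul, mul_one]
  congr 2
  ext e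
  simp [and_comm]

theorem card_inter_eq_sum (S G : Finset (EdgeType n)) :
    ((G ∩ S).card : ℝ) = ∑ e ∈ G, if e ∈ S then 1 else 0 := by
  rw [← Finset.sum_filter, Finset.sum_const, nsmul_eq_mul, mul_one, Finset.filter_mem_eq_inter]

theorem sepOut_succ_le {d r m : ℕ} (hr : 1 ≤ r) (hm : m < Fintype.card (EdgeType n)) :
    sepOut n (d + 1) r m ≤ sepIn n d r (m + 1) := by
  have h := uniformAvg_insert hm
    (fun (H : EdgeSetGraph n) e => if e ∈ separable d r H then (1 : ℝ) else 0)
  have hpos : (0 : ℝ) < Fintype.card (EdgeType n) - m := by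
    rw [sub_pos]; exact_mod_cast hm
  simp only [sepIn, card_inter_eq_sum]
  push_cast
  rw [← h, sepOut]
  refine uniformAvg_mono fun G _ => ?_
  rw [card_sdiff_eq_sum]
  gcongr with e he
  rw [Finset.mem_compl] at he
  by_cases h1 : e ∈ separable (d + 1) r G
  · rw [if_pos h1, if_pos (mem_separable_insert hr he h1)]
  · rw [if_neg h1]
    split_ifs <;> norm_num

theorem sepOut_zero_le {r m : ℕ} (hr : 1 ≤ r) (hm : m < Fintype.card (EdgeType n)) :
    sepOut n 0 r m ≤
      uniformAvg (m + 1) fun H : EdgeSetGraph n => (maxCut n r H : ℝ) / ((m + 1 : ℕ) : ℝ) := by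
  choose M hM using exists_cutSize_eq_maxCut (n := n) hr
  have h := uniformAvg_insert hm
    (fun (H : EdgeSetGraph n) e => if e ∈ crossing (M H) then (1 : ℝ) else 0)
  have hpos : (0 : ℝ) < Fintype.card (EdgeType n) - m := by
    rw [sub_pos]; exact_mod_cast hm
  simp only [← hM, cutSize_eq_card_inter, card_inter_eq_sum]
  push_cast
  rw [← h, sepOut]
  refine uniformAvg_mono fun G _ => ?_
  rw [card_sdiff_eq_sum]
  gcongr with e he
  rw [Finset.mem_compl] at he
  by_cases h1 : e ∈ separable 0 r G
  · rw [if_pos h1, if_pos (mem_crossing_of_mem_separable_zero he h1 (hM _))]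
  · rw [if_neg h1]
    split_ifs <;> norm_num

theorem exists_bipartition_discrepancy_bound {m : ℕ} (hn : 1 ≤ n) (hnm : n ≤ m)
    (hm : m ≤ Fintype.card (EdgeType n)) :
    ∃ D : EdgeSetGraph n → ℝ, (∀ G : EdgeSetGraph n, G.card = m →
        ∀ χ : Fin n → Bool, |discrepancy (crossing χ) G| ≤ D G) ∧
      uniformAvg m D ≤ 3 * (m * Real.sqrt (n / m)) :=
  exists_discrepancy_bound hn hnm hm (by simp) crossing

theorem card_inter_crossing_le {G : EdgeSetGraph n} {D : ℝ}
    (hD : ∀ χ : Fin n → Bool, |discrepancy (crossing χ) G| ≤ D) {ι : Type*} [Fintype ι]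
    (f : Fin n → ι) :
    ((G ∩ crossing f).card : ℝ) ≤
      (G.card : ℝ) / Fintype.card (EdgeType n) * (crossing f).card + 2 * D := by
  have := (le_abs_self _).trans (abs_discrepancy_crossing_le hD f)
  unfold discrepancy at this
  linarith

theorem card_separable_eq (d r : ℕ) (G : EdgeSetGraph n) :
    ((separable d r G).card : ℝ) =
      (G ∩ separable d r G).card + (separable d r G \ G).card := by
  have := Finset.card_inter_add_card_sdiff (separable d r G) G
  rw [Finset.inter_comm] at this
  exact_mod_cast this.symm

theorem card_inter_separable_div_le {d r m : ℕ} {G : EdgeSetGraph n} (hG : G.card = m) {D : ℝ}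
    (hD : ∀ χ : Fin n → Bool, |discrepancy (crossing χ) G| ≤ D) (hm0 : 0 < m)
    (hm : m < Fintype.card (EdgeType n)) :
    ((G ∩ separable d r G).card : ℝ) / m ≤
      ((separable d r G \ G).card : ℝ) / (Fintype.card (EdgeType n) - m) +
        2 * Fintype.card (EdgeType n) / (m * (Fintype.card (EdgeType n) - m)) * D := by
  have h := card_inter_crossing_le hD (component d r G)
  change ((G ∩ separable d r G).card : ℝ) ≤ _ / _ * (separable d r G).card + _ at h
  rw [card_separable_eq, hG] at h
  have hm0' : (0 : ℝ) < m := by exact_mod_cast hm0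
  have hpos : (0 : ℝ) < Fintype.card (EdgeType n) - m := by
    rw [sub_pos]; exact_mod_cast hm
  set N : ℝ := (Fintype.card (EdgeType n) : ℝ)
  have hN : 0 < N := by linarith
  set a : ℝ := ((G ∩ separable d r G).card : ℝ)
  set b : ℝ := ((separable d r G \ G).card : ℝ)
  have h' : a * N ≤ m * (a + b) + 2 * D * N := by
    have := mul_le_mul_of_nonneg_right h hN.le
    have e : ((m : ℝ) / N * (a + b) + 2 * D) * N = m * (a + b) + 2 * D * N := by
      field_simp
    linarith
  have e : b / (N - m) + 2 * N / (m * (N - m)) * D = (m * b + 2 * D * N) / (m * (N - m)) := by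
    field_simp
  rw [e, div_le_div_iff₀ hm0' (by positivity)]
  nlinarith

theorem sepIn_le {d r m : ℕ} (hn : 1 ≤ n) (hnm : n ≤ m) (hm : m < Fintype.card (EdgeType n)) :
    sepIn n d r m ≤ sepOut n d r m +
      6 * Real.sqrt (n / m) * (Fintype.card (EdgeType n) / (Fintype.card (EdgeType n) - m)) := by
  obtain ⟨D, hD, hDavg⟩ := exists_bipartition_discrepancy_bound hn hnm hm.le
  have hm0 : 0 < m := by omega
  have hm0' : (0 : ℝ) < m := by exact_mod_cast hm0
  have hpos : (0 : ℝ) < (Fintype.card (EdgeType n) : ℝ) - m := by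
    rw [sub_pos]; exact_mod_cast hm
  have h := uniformAvg_mono (m := m) fun (G : EdgeSetGraph n) hG =>
    card_inter_separable_div_le (d := d) (r := r) hG (hD G hG) hm0 hm
  rw [uniformAvg_add, uniformAvg_const_mul] at h
  refine h.trans (add_le_add le_rfl ?_)
  refine (mul_le_mul_of_nonneg_left hDavg (by positivity)).trans (le_of_eq ?_)
  field_simp
  ring

theorem uniformAvg_maxCut_div_le {r m : ℕ} (hr : 1 ≤ r) (hn : 1 ≤ n) (hnm : n ≤ m)
    (hm : m ≤ Fintype.card (EdgeType n)) :
    (uniformAvg m fun G : EdgeSetGraph n => (maxCut n r G : ℝ) / m) ≤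
      (1 - 1 / r) * (n : ℝ) ^ 2 / (2 * Fintype.card (EdgeType n)) + 6 * Real.sqrt (n / m) := by
  obtain ⟨D, hD, hDavg⟩ := exists_bipartition_discrepancy_bound hn hnm hm
  have hm0' : (0 : ℝ) < m := by exact_mod_cast (by omega : 0 < m)
  have hN : (0 : ℝ) < Fintype.card (EdgeType n) := by
    exact_mod_cast (by omega : 0 < Fintype.card (EdgeType n))
  have h : (uniformAvg m fun G : EdgeSetGraph n => (maxCut n r G : ℝ) / m) ≤
      uniformAvg m fun G => (1 - 1 / r) * (n : ℝ) ^ 2 / (2 * Fintype.card (EdgeType n)) +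
        2 / m * D G := by
    refine uniformAvg_mono fun G hG => ?_
    obtain ⟨φ, hφ⟩ := exists_cutSize_eq_maxCut hr G
    have h1 := card_inter_crossing_le (hD G hG) φ
    rw [← cutSize_eq_card_inter, hφ, hG] at h1
    have h2 := card_crossing_le hr φ
    rw [div_le_iff₀ hm0']
    calc (maxCut n r G : ℝ)
        ≤ (m : ℝ) / Fintype.card (EdgeType n) * ((1 - 1 / r) * (n : ℝ) ^ 2 / 2) + 2 * D G := by
          refine h1.trans ?_
          gcongr
          linarith
      _ = _ := by field_simp
  rw [uniformAvg_add, uniformAvg_const hm, uniformAvg_const_mul] at h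
  refine h.trans (add_le_add le_rfl ?_)
  refine (mul_le_mul_of_nonneg_left hDavg (by positivity)).trans (le_of_eq ?_)
  field_simp
  norm_num

theorem sepOut_le {r : ℕ} (hr : 1 ≤ r) (hn : 1 ≤ n) {δ : ℝ} (hδ : 0 < δ) (d : ℕ) :
    ∀ m : ℕ, n ≤ m → m + d + 1 ≤ Fintype.card (EdgeType n) →
      δ * Fintype.card (EdgeType n) ≤ Fintype.card (EdgeType n) - (m + d) →
      sepOut n d r m ≤ (1 - 1 / r) * (n : ℝ) ^ 2 / (2 * Fintype.card (EdgeType n)) +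
        6 * Real.sqrt (n / m) * (d / δ + 1) := by
  have hsqrt : ∀ m : ℕ, n ≤ m →
      Real.sqrt (n / ((m + 1 : ℕ) : ℝ)) ≤ Real.sqrt (n / m) := by
    intro m hnm
    have hm0' : (0 : ℝ) < m := by exact_mod_cast (by omega : 0 < m)
    refine Real.sqrt_le_sqrt ?_
    gcongr
    omega
  induction d with
  | zero =>
    intro m hnm hm _
    refine (sepOut_zero_le hr (by omega)).trans
      ((uniformAvg_maxCut_div_le hr hn (by omega) (by omega)).trans ?_)
    have := hsqrt m hnm
    simp only [CharP.cast_eq_zero, zero_div, zero_add, mul_one]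
    linarith
  | succ d ih =>
    intro m hnm hm hδm
    have h1 := sepOut_succ_le (n := n) (d := d) (r := r) (m := m) hr (by omega)
    have h2 := sepIn_le (n := n) (d := d) (r := r) (m := m + 1) hn (by omega) (by omega)
    have h3 := ih (m + 1) (by omega) (by omega) (by push_cast at hδm ⊢; linarith)
    have hs := hsqrt m hnm
    push_cast at hδm h2 h3 hs ⊢
    have hN : (0 : ℝ) < Fintype.card (EdgeType n) := by
      exact_mod_cast (by omega : 0 < Fintype.card (EdgeType n))
    set N : ℝ := (Fintype.card (EdgeType n) : ℝ)
    have hNδ : δ * N ≤ N - (m + 1) := by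
      have : (0 : ℝ) ≤ d := by positivity
      linarith
    have hNm : 0 < N - (m + 1) := lt_of_lt_of_le (by positivity) hNδ
    have hfrac : N / (N - (m + 1)) ≤ 1 / δ := by
      rw [div_le_div_iff₀ hNm hδ]
      linarith
    set s' := Real.sqrt (n / ((m : ℝ) + 1))
    set s := Real.sqrt ((n : ℝ) / m)
    have hs0 : 0 ≤ s' := Real.sqrt_nonneg _
    have h4 : 6 * s' * (N / (N - (m + 1))) ≤ 6 * s * (1 / δ) := by gcongr
    have h5 : 6 * s' * (d / δ + 1) ≤ 6 * s * (d / δ + 1) := by gcongr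
    have h6 : 6 * s * (((d : ℝ) + 1) / δ + 1) = 6 * s * (d / δ + 1) + 6 * s * (1 / δ) := by ring
    linarith

end Separable

section Core

variable {n : ℕ}

theorem component_subset_part {d r : ℕ} {G : EdgeSetGraph n} {φ : Fin n → Fin r}
    (hφ : cutSize φ G = maxCut n r G) (u : Fin n) :
    component d r G u ⊆ Finset.univ.filter fun v => φ v = φ u := by
  intro v hv
  rw [mem_component] at hv
  simp only [Finset.mem_filter, Finset.mem_univ, true_and]
  exact (hv φ (by rw [deficit_le_iff]; omega)).symm

theorem card_component_le_partSize {d r : ℕ} {G : EdgeSetGraph n} {φ : Fin n → Fin r}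
    (hφ : cutSize φ G = maxCut n r G) (u : Fin n) :
    ((component d r G u).card : ℝ) ≤ partSize φ (φ u) := by
  unfold partSize
  exact_mod_cast Finset.card_le_card (component_subset_part hφ u)

theorem two_mul_card_edgeType : 2 * (Fintype.card (EdgeType n) : ℝ) = (n : ℝ) ^ 2 - n := by
  rw [card_edgeType, Nat.cast_choose_two]
  ring

theorem sum_partSize_sq_le {r m : ℕ} (hr : 1 ≤ r) (hn : 1 ≤ n) (hm : 0 < m)
    {G : EdgeSetGraph n} (hG : G.card = m) {D : ℝ}
    (hD : ∀ χ : Fin n → Bool, |discrepancy (crossing χ) G| ≤ D) {φ : Fin n → Fin r}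
    (hφ : cutSize φ G = maxCut n r G) :
    ∑ i, partSize φ i ^ 2 ≤ (n : ℝ) ^ 2 / r + (1 / n + 2 / m * D) * (n : ℝ) ^ 2 := by
  have hn0 : (0 : ℝ) < n := by exact_mod_cast hn
  have hm0 : (0 : ℝ) < m := by exact_mod_cast hm
  have hr0 : (0 : ℝ) < r := by exact_mod_cast hr
  have hD0 : 0 ≤ D := (abs_nonneg _).trans (hD fun _ => true)
  have hN2 := two_mul_card_edgeType (n := n)
  have hmN : m ≤ Fintype.card (EdgeType n) := hG ▸ Finset.card_le_univ G
  have hN : (0 : ℝ) < Fintype.card (EdgeType n) := by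
    exact_mod_cast (by omega : 0 < Fintype.card (EdgeType n))
  have h1 := card_inter_crossing_le hD φ
  have h2 := mul_card_le_maxCut hr G
  rw [← cutSize_eq_card_inter, hφ, hG] at h1
  rw [hG] at h2
  rw [sum_partSize_sq]
  set N : ℝ := (Fintype.card (EdgeType n) : ℝ)
  set w : ℝ := ((crossing φ).card : ℝ)
  set p : ℝ := 1 - 1 / (r : ℝ) with hp
  have hp1 : p ≤ 1 := by
    have : 0 < 1 / (r : ℝ) := by positivity
    linarith
  have h3 : p * N ≤ w + 2 / m * D * N := by
    have h := mul_le_mul_of_nonneg_right (h2.trans h1) (by positivity : 0 ≤ N / m)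
    have e1 : p * m * (N / m) = p * N := by field_simp
    have e2 : ((m : ℝ) / N * w + 2 * D) * (N / m) = w + 2 / m * D * N := by field_simp
    linarith
  have h4 : 2 / m * D * (2 * N) ≤ 2 / m * D * (n : ℝ) ^ 2 := by
    gcongr
    linarith
  have h5 : (1 / (n : ℝ)) * (n : ℝ) ^ 2 = n := by field_simp
  have h6 : p * (2 * N) = (n : ℝ) ^ 2 - (n : ℝ) ^ 2 / r - p * n := by
    rw [hN2, hp]; ring
  have h7 : p * n ≤ n := by nlinarith
  rw [add_mul, h5]
  linarith

/-- The number of inseparable pairs is at most the number of pairs inside the parts of an optimal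
cut, which is nearly balanced. -/
theorem le_two_mul_card_separable {d r m : ℕ} (hr : 1 ≤ r) (hn : 1 ≤ n) (hm : 0 < m)
    {G : EdgeSetGraph n} (hG : G.card = m) {D : ℝ}
    (hD : ∀ χ : Fin n → Bool, |discrepancy (crossing χ) G| ≤ D) :
    (1 - 1 / (r : ℝ) - (1 / n + 2 / m * D)) * (n : ℝ) ^ 2 ≤ 2 * (separable d r G).card := by
  obtain ⟨φ, hφ⟩ := exists_cutSize_eq_maxCut hr G
  have h1 := sum_card_component d r G
  have h2 : ∑ u, ((component d r G u).card : ℝ) ≤ ∑ i, partSize φ i ^ 2 := by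
    calc _ ≤ ∑ u, partSize φ (φ u) :=
          Finset.sum_le_sum fun u _ => card_component_le_partSize hφ u
      _ = _ := by
          rw [sum_comp_eq_sum_partSize_mul]
          exact Finset.sum_congr rfl fun i _ => (sq _).symm
  have h3 := sum_partSize_sq_le hr hn hm hG hD hφ
  have h4 : (1 - 1 / (r : ℝ) - (1 / n + 2 / m * D)) * (n : ℝ) ^ 2 =
    (n : ℝ) ^ 2 - (n : ℝ) ^ 2 / r - (1 / n + 2 / m * D) * (n : ℝ) ^ 2 := by ring
  linarith

theorem card_coreSets_le (hn : 1 ≤ n) (d r : ℕ) (G : EdgeSetGraph n) :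
    (coreSets d r G).card ≤ r := by
  have hn0 : (0 : ℝ) < n := by exact_mod_cast hn
  by_contra! h
  have hdisj : ((coreSets d r G : Finset (Finset (Fin n))) : Set (Finset (Fin n))).PairwiseDisjoint
      id := by
    intro S hS T hT hST
    simp only [coreSets, Finset.coe_filter, Finset.mem_image, Finset.mem_univ, true_and,
      Set.mem_ofPred_eq] at hS hT
    obtain ⟨⟨u, rfl⟩, -⟩ := hS
    obtain ⟨⟨v, rfl⟩, -⟩ := hT
    refine Finset.disjoint_left.2 fun w hw hw' => hST ?_
    simp only [id, mem_component, ← component_eq_iff] at hw hw'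
    exact hw.trans hw'.symm
  have h1 : ∑ S ∈ coreSets d r G, S.card ≤ n := by
    have h2 := Finset.card_biUnion hdisj
    simp only [id] at h2
    rw [← h2]
    exact (Finset.card_le_univ _).trans (by simp)
  have h2 : ((coreSets d r G).card : ℝ) * ((n : ℝ) / (r + 1)) <
      ∑ S ∈ coreSets d r G, (S.card : ℝ) := by
    rw [← nsmul_eq_mul, ← Finset.sum_const]
    refine Finset.sum_lt_sum_of_nonempty (Finset.card_pos.1 (by omega)) fun S hS => ?_
    exact (Finset.mem_filter.1 hS).2
  have h3 : ∑ S ∈ coreSets d r G, (S.card : ℝ) ≤ n := by exact_mod_cast h1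
  have h4 : ((r : ℝ) + 1) * ((n : ℝ) / (r + 1)) ≤
      ((coreSets d r G).card : ℝ) * ((n : ℝ) / (r + 1)) := by
    gcongr
    exact_mod_cast h
  have h5 : ((r : ℝ) + 1) * ((n : ℝ) / (r + 1)) = n := by field_simp
  linarith

theorem inCORE_of_exists_large_component (hn : 1 ≤ n) {d r : ℕ} (hr : 1 ≤ r) {α : ℝ}
    (hα : α < 1 / ((r : ℝ) ^ 2 + r)) {G : EdgeSetGraph n} {φ : Fin n → Fin r}
    (hφ : cutSize φ G = maxCut n r G)
    (h : ∀ i, ∃ u, φ u = i ∧ (n : ℝ) / r - α * n ≤ (component d r G u).card) :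
    InCORE d r α G := by
  have hn0 : (0 : ℝ) < n := by exact_mod_cast hn
  have hr0 : (0 : ℝ) < r := by exact_mod_cast hr
  choose x hx hcard using h
  have hlt : (n : ℝ) / (r + 1) < n / r - α * n := by
    have h1 : α * n < 1 / ((r : ℝ) ^ 2 + r) * n := by gcongr
    have h2 : (n : ℝ) / r - 1 / ((r : ℝ) ^ 2 + r) * n = n / (r + 1) := by
      field_simp
      ring
    linarith
  have hsub : Finset.univ.image (fun i => component d r G (x i)) ⊆ coreSets d r G := by
    intro S hS
    simp only [Finset.mem_image, Finset.mem_univ, true_and] at hS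
    obtain ⟨i, rfl⟩ := hS
    simp only [coreSets, Finset.mem_filter, Finset.mem_image, Finset.mem_univ, true_and]
    exact ⟨⟨_, rfl⟩, hlt.trans_le (hcard i)⟩
  have hinj : Function.Injective fun i => component d r G (x i) := by
    intro i j hij
    have := component_eq_iff.1 hij φ (by rw [deficit_le_iff]; omega)
    rwa [hx, hx] at this
  have himg : (Finset.univ.image (fun i => component d r G (x i))).card = r := by
    rw [Finset.card_image_of_injective _ hinj, Finset.card_univ, Fintype.card_fin]
  have hle := card_coreSets_le hn d r G
  have heq := Finset.eq_of_subset_of_card_le hsub (by rw [himg]; exact hle)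
  refine ⟨?_, ?_⟩
  · rw [HasCore, ← heq, himg]
  · intro S hS
    rw [← heq] at hS
    simp only [Finset.mem_image, Finset.mem_univ, true_and] at hS
    obtain ⟨i, rfl⟩ := hS
    exact hcard i

theorem inCORE_of_card_separable_lt {d r m : ℕ} (hr : 2 ≤ r) (hn : 1 ≤ n) (hm : 0 < m)
    {G : EdgeSetGraph n} (hG : G.card = m) {D α : ℝ}
    (hD : ∀ χ : Fin n → Bool, |discrepancy (crossing χ) G| ≤ D) (hα0 : 0 < α)
    (hα : α < 1 / ((r : ℝ) ^ 2 + r)) (hκ : 1 / n + 2 / m * D ≤ α ^ 2 / 4)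
    (hsep : 2 * ((separable d r G).card : ℝ) <
      (1 - 1 / r + α / (4 * r) - (1 / n + 2 / m * D)) * (n : ℝ) ^ 2) :
    InCORE d r α G := by
  have hn0 : (0 : ℝ) < n := by exact_mod_cast hn
  have hr0 : (0 : ℝ) < r := by exact_mod_cast (by omega : 0 < r)
  obtain ⟨φ, hφ⟩ := exists_cutSize_eq_maxCut (by omega : 1 ≤ r) G
  refine inCORE_of_exists_large_component hn (by omega) hα hφ fun i => ?_
  by_contra! hsmall
  have hsq := sum_partSize_sq_le (by omega) hn hm hG hD hφ
  have hdev := sum_partSize_sub_sq (by omega) φ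
  set κ : ℝ := 1 / n + 2 / m * D
  have hi : (partSize φ i - n / r) ^ 2 ≤ (α * n / 2) ^ 2 := by
    have h1 : (partSize φ i - n / r) ^ 2 ≤ ∑ j, (partSize φ j - n / r) ^ 2 :=
      Finset.single_le_sum (f := fun j => (partSize φ j - n / r) ^ 2)
        (fun j _ => sq_nonneg _) (Finset.mem_univ i)
    have h2 : κ * (n : ℝ) ^ 2 ≤ α ^ 2 / 4 * (n : ℝ) ^ 2 := by gcongr
    have h3 : (α * n / 2) ^ 2 = α ^ 2 / 4 * (n : ℝ) ^ 2 := by ring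
    linarith
  have habs := abs_le_of_sq_le_sq' hi (by positivity)
  have hαr : α < 1 / r := by
    refine hα.trans_le ?_
    gcongr
    nlinarith
  have hαn : α * n ≤ n / r := by
    calc α * n ≤ 1 / r * n := by gcongr
      _ = n / r := by ring
  have hpart : (n : ℝ) / (2 * r) ≤ partSize φ i := by
    have : (n : ℝ) / (2 * r) = n / r - n / r / 2 := by field_simp; norm_num
    linarith [habs.1]
  have hgap : α * n / 2 ≤ partSize φ i - (n / r - α * n) := by linarith [habs.1]
  set g : Fin r → ℝ := fun j => if j = i then n / r - α * n else partSize φ j with hg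
  have hsum : ∑ u, ((component d r G u).card : ℝ) ≤ ∑ j, partSize φ j * g j := by
    rw [← sum_comp_eq_sum_partSize_mul]
    refine Finset.sum_le_sum fun u _ => ?_
    by_cases hu : φ u = i
    · simp only [hg, hu, if_true]
      exact (hsmall u hu).le
    · simp only [hg, hu, if_false]
      exact card_component_le_partSize hφ u
  have hg' : ∑ j, partSize φ j * g j =
      ∑ j, partSize φ j ^ 2 - partSize φ i * (partSize φ i - (n / r - α * n)) := by
    rw [eq_sub_iff_add_eq, ← eq_sub_iff_add_eq', ← Finset.sum_sub_distrib,
      Finset.sum_eq_single i]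
    · simp only [hg, if_true]
      ring
    · intro j _ hj
      simp only [hg, hj, if_false]
      ring
    · simp
  have hprod : (n : ℝ) / (2 * r) * (α * n / 2) ≤
      partSize φ i * (partSize φ i - (n / r - α * n)) := by
    gcongr
    exact le_trans (by positivity) hpart
  have hprod' : (n : ℝ) / (2 * r) * (α * n / 2) = α / (4 * r) * (n : ℝ) ^ 2 := by
    field_simp; norm_num
  have htot := sum_card_component d r G
  have hexp : (1 - 1 / r + α / (4 * r) - κ) * (n : ℝ) ^ 2 =
    (n : ℝ) ^ 2 - (n : ℝ) ^ 2 / r + α / (4 * r) * (n : ℝ) ^ 2 - κ * (n : ℝ) ^ 2 := by ring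
  linarith

theorem prGnm_eq_uniformAvg (n m : ℕ) (A : EdgeSetGraph n → Prop) :
    prGnm n m A = uniformAvg m fun G => if A G then 1 else 0 := by
  have h : (Finset.univ.filter fun G : EdgeSetGraph n => G.card = m) =
      Finset.powersetCard m Finset.univ := by
    ext G; simp
  rw [prGnm, uniformAvg, ← Finset.sum_filter, ← Finset.filter_filter, h, Finset.sum_const,
    nsmul_eq_mul, mul_one, Finset.card_powersetCard, Finset.card_univ]

theorem prGnm_le_one (n m : ℕ) (A : EdgeSetGraph n → Prop) : prGnm n m A ≤ 1 := by
  refine div_le_one_of_le₀ ?_ (by positivity)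
  exact_mod_cast Finset.card_le_card fun G hG => by
    simp only [Finset.mem_filter] at hG ⊢
    exact ⟨hG.1, hG.2.1⟩

/-- The first moment bound, before optimizing the dependence on `α`. -/
theorem prGnm_not_inCORE_le {d m r : ℕ} {α δ : ℝ} (hr : 2 ≤ r) (hn : 1 ≤ n) (hnm : n ≤ m)
    (hα0 : 0 < α) (hα : α < 1 / ((r : ℝ) ^ 2 + r)) (hδ : 0 < δ) (hδ1 : δ ≤ 1)
    (hm : m + d + 1 ≤ Fintype.card (EdgeType n))
    (hδm : δ * Fintype.card (EdgeType n) ≤ Fintype.card (EdgeType n) - (m + d)) :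
    prGnm n m (fun G => ¬ InCORE d r α G) ≤
      4 * r / α * (19 * ((d + 1) / δ) * Real.sqrt (n / m)) +
        28 * Real.sqrt (n / m) / α ^ 2 := by
  obtain ⟨D, hD, hDavg⟩ := exists_bipartition_discrepancy_bound hn hnm (by omega)
  have hout := sepOut_le (r := r) (by omega) hn hδ d m hnm hm hδm
  have hm0 : 0 < m := by omega
  have hm0' : (0 : ℝ) < m := by exact_mod_cast hm0
  have hn0 : (0 : ℝ) < n := by exact_mod_cast hn
  have hr0 : (0 : ℝ) < r := by exact_mod_cast (by omega : 0 < r)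
  have hmN : m < Fintype.card (EdgeType n) := by omega
  have hmN' : (m : ℝ) < Fintype.card (EdgeType n) := by exact_mod_cast hmN
  have hN2 := two_mul_card_edgeType (n := n)
  set N : ℝ := (Fintype.card (EdgeType n) : ℝ) with hNdef
  set s : ℝ := Real.sqrt (n / m) with hs
  set p : ℝ := 1 - 1 / (r : ℝ) with hp
  have hs0 : 0 ≤ s := Real.sqrt_nonneg _
  have hNpos : 0 < N := hm0'.trans hmN'
  have hNm : 0 < N - m := by linarith
  have hd0 : (0 : ℝ) ≤ d := by positivity
  set κ : EdgeSetGraph n → ℝ := fun G => 1 / n + 2 / m * D G with hκ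
  set Z : EdgeSetGraph n → ℝ := fun G => 2 * N / (n : ℝ) ^ 2 *
    (((separable d r G \ G).card : ℝ) / (N - m)) +
      4 * N / ((n : ℝ) ^ 2 * (N - m)) * D G with hZ
  have hsepZ : ∀ G : EdgeSetGraph n, G.card = m →
      2 * ((separable d r G).card : ℝ) ≤ Z G * (n : ℝ) ^ 2 := by
    intro G hG
    have h := card_inter_separable_div_le (d := d) (r := r) hG (hD G hG) hm0 hmN
    rw [← hNdef, div_le_iff₀ hm0'] at h
    rw [card_separable_eq]
    set a : ℝ := ((G ∩ separable d r G).card : ℝ)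
    set b : ℝ := ((separable d r G \ G).card : ℝ) with hb
    have e : Z G * (n : ℝ) ^ 2 =
        2 * ((b / (N - m) + 2 * N / (m * (N - m)) * D G) * m + b) := by
      simp only [hZ, ← hb]
      field_simp
      ring
    linarith
  obtain ⟨A, hA⟩ : ∃ A : EdgeSetGraph n → Prop, A = fun G => ¬ InCORE d r α G := ⟨_, rfl⟩
  rw [← hA]
  have hpt : ∀ G : EdgeSetGraph n, G.card = m → (if A G then (1 : ℝ) else 0) ≤
      4 * r / α * (Z G + (κ G + -p)) + 4 / α ^ 2 * κ G := by
    intro G hG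
    have hlow := le_two_mul_card_separable (d := d) (r := r) (by omega) hn hm0 hG (hD G hG)
    have hκG : κ G = 1 / n + 2 / m * D G := rfl
    have hD0 : 0 ≤ D G := (abs_nonneg _).trans (hD G hG fun _ => true)
    have hκ0 : 0 ≤ κ G := by rw [hκG]; positivity
    rw [← hκG, ← hp] at hlow
    have hY : 0 ≤ Z G + (κ G + -p) := by
      have h1 := le_of_mul_le_mul_right (hlow.trans (hsepZ G hG)) (by positivity)
      linarith
    have t1 : 0 ≤ 4 * r / α * (Z G + (κ G + -p)) := by positivity
    have t2 : 0 ≤ 4 / α ^ 2 * κ G := by positivity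
    split_ifs with hAG
    · have hcore : ¬ InCORE d r α G := by rwa [hA] at hAG
      by_cases h1 : κ G ≤ α ^ 2 / 4
      · have h2 : ¬ 2 * ((separable d r G).card : ℝ) <
            (1 - 1 / r + α / (4 * r) - (1 / n + 2 / m * D G)) * (n : ℝ) ^ 2 := fun h2 =>
          hcore (inCORE_of_card_separable_lt hr hn hm0 hG (hD G hG) hα0 hα h1 h2)
        rw [not_lt] at h2
        have h3 := le_of_mul_le_mul_right (h2.trans (hsepZ G hG)) (by positivity)
        have h4 : 4 * r / α * (α / (4 * r)) ≤ 4 * r / α * (Z G + (κ G + -p)) := by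
          gcongr
          linarith
        have h5 : 4 * r / α * (α / (4 * r)) = 1 := by field_simp
        linarith
      · have h2 : 4 / α ^ 2 * (α ^ 2 / 4) ≤ 4 / α ^ 2 * κ G := by
          gcongr
          linarith
        have h3 : 4 / α ^ 2 * (α ^ 2 / 4) = 1 := by field_simp
        linarith
    · linarith
  have hinv : 1 / (n : ℝ) ≤ s := by
    rw [hs]
    refine Real.le_sqrt_of_sq_le ?_
    rw [div_pow, one_pow, div_le_div_iff₀ (by positivity) hm0']
    have h1 : (1 : ℝ) ≤ n := by exact_mod_cast hn
    have h2 : (m : ℝ) ≤ (n : ℝ) ^ 2 := by linarith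
    nlinarith [sq_nonneg (n : ℝ)]
  have hκavg : uniformAvg m κ ≤ 7 * s := by
    rw [hκ, uniformAvg_add, uniformAvg_const hmN.le, uniformAvg_const_mul]
    have : 2 / m * uniformAvg m D ≤ 2 / m * (3 * (m * s)) := by gcongr
    have e : 2 / (m : ℝ) * (3 * (m * s)) = 6 * s := by field_simp; ring
    linarith
  have hZavg : uniformAvg m Z ≤ p + 6 * s * (d / δ + 1) + 6 * s / δ := by
    have h1 : uniformAvg m Z = 2 * N / (n : ℝ) ^ 2 * sepOut n d r m +
        4 * N / ((n : ℝ) ^ 2 * (N - m)) * uniformAvg m D := by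
      rw [hZ, uniformAvg_add, uniformAvg_const_mul, uniformAvg_const_mul, sepOut]
    have h2 : 2 * N / (n : ℝ) ^ 2 ≤ 1 := by
      rw [div_le_one (by positivity)]
      linarith
    have h3 : 2 * N / (n : ℝ) ^ 2 * sepOut n d r m ≤ p + 6 * s * (d / δ + 1) := by
      calc _ ≤ 2 * N / (n : ℝ) ^ 2 * (p * (n : ℝ) ^ 2 / (2 * N) + 6 * s * (d / δ + 1)) := by
            gcongr
        _ = p + 2 * N / (n : ℝ) ^ 2 * (6 * s * (d / δ + 1)) := by field_simp
        _ ≤ p + 1 * (6 * s * (d / δ + 1)) := by gcongr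
        _ = _ := by ring
    have h4 : m / (N - m) ≤ 1 / δ := by
      rw [div_le_div_iff₀ hNm hδ]
      nlinarith
    have h5 : 4 * N / ((n : ℝ) ^ 2 * (N - m)) * uniformAvg m D ≤ 6 * s / δ := by
      calc _ ≤ 4 * N / ((n : ℝ) ^ 2 * (N - m)) * (3 * (m * s)) := by gcongr
        _ = 2 * N / (n : ℝ) ^ 2 * (6 * s * (m / (N - m))) := by field_simp; ring
        _ ≤ 1 * (6 * s * (1 / δ)) := by gcongr
        _ = _ := by ring
    linarith
  rw [prGnm_eq_uniformAvg]
  clear_value Z κ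
  refine (uniformAvg_mono hpt).trans ?_
  rw [uniformAvg_add, uniformAvg_const_mul, uniformAvg_const_mul, uniformAvg_add,
    uniformAvg_add, uniformAvg_const hmN.le]
  have hfin : uniformAvg m Z + (uniformAvg m κ + -p) ≤ 19 * ((d + 1) / δ) * s := by
    have h1 : 1 ≤ 1 / δ := by rwa [le_div_iff₀ hδ, one_mul]
    have h2 : s ≤ 1 / δ * s := le_mul_of_one_le_left hs0 h1
    have h3 : 0 ≤ (d : ℝ) / δ * s := by positivity
    have e : 19 * (((d : ℝ) + 1) / δ) * s = 19 * (d / δ * s) + 19 * (1 / δ * s) := by ring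
    have e' : 6 * s * (d / δ + 1) + 6 * s / δ = 6 * (d / δ * s) + 6 * s + 6 * (1 / δ * s) := by
      ring
    linarith
  have h6 : 4 / α ^ 2 * uniformAvg m κ ≤ 28 * s / α ^ 2 := by
    calc _ ≤ 4 / α ^ 2 * (7 * s) := by gcongr
      _ = _ := by ring
  exact add_le_add (by gcongr) h6

end Core

/-- The second term of the first moment bound, which is quadratic in `q / α`, may be replaced by
a linear one since `p ≤ 1`. -/
theorem le_linear_bound_of_le_one {p α δ r d q s : ℝ} (hp : p ≤ 1) (hα : 0 < α) (hδ : 0 < δ)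
    (hr : 2 ≤ r) (hd : 0 ≤ d) (hs : 0 ≤ s) (hq : 0 ≤ q) (hqs : q ^ 2 = s)
    (h : p ≤ 4 * r / α * (19 * ((d + 1) / (δ / 2)) * s) + 28 * s / α ^ 2) :
    p ≤ 400 * r ^ 2 / α * (((d + 1) / δ + r) * s + q) := by
  have hr0 : 0 ≤ r := by linarith
  have hA : 0 ≤ (d + 1) / δ * s := by positivity
  have e1 : 4 * r / α * (19 * ((d + 1) / (δ / 2)) * s) = 152 * (r / α) * ((d + 1) / δ * s) := by
    field_simp; ring
  have e2 : 28 * s / α ^ 2 = 28 * (q / α) ^ 2 := by rw [← hqs]; ring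
  have e3 : 400 * r ^ 2 / α * (((d + 1) / δ + r) * s + q) =
      400 * (r ^ 2 / α) * ((d + 1) / δ * s) + 400 * (r ^ 2 / α) * (r * s) +
        400 * r ^ 2 * (q / α) := by ring
  have h1 : 152 * (r / α) * ((d + 1) / δ * s) ≤ 400 * (r ^ 2 / α) * ((d + 1) / δ * s) := by
    have hra : r / α ≤ r ^ 2 / α := div_le_div_of_nonneg_right (by nlinarith) hα.le
    have hra0 : 0 ≤ r / α := by positivity
    exact mul_le_mul_of_nonneg_right (by linarith) hA
  have hx : 0 ≤ q / α := by positivity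
  have h2 : 6 * (q / α) ≤ 400 * r ^ 2 * (q / α) :=
    mul_le_mul_of_nonneg_right (by nlinarith) hx
  have h3 : 0 ≤ 400 * (r ^ 2 / α) * (r * s) := by positivity
  rw [e1, e2] at h
  rw [e3]
  by_cases hqα : 1 ≤ 6 * (q / α)
  · have h4 : 0 ≤ 400 * (r ^ 2 / α) * ((d + 1) / δ * s) := by positivity
    linarith
  · have h4 : 28 * (q / α) ^ 2 ≤ 6 * (q / α) := by nlinarith
    linarith

/-- There is an absolute constant `C` such that for all `α, δ ∈ (0,1)` and all `d, m, n, r`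
with `r ≥ 2`, `α < 1/(r²+r)` and `1 ≤ m ≤ (1-δ) C(n,2)`, the probability that
`G(n,m) ∉ CORE_d^r(α)` is at most `(Cr²/α) ((((d+1)/δ) + r) √(n/m) + (n/m)^{1/4})`. -/
theorem prob_not_CORE :
    ∃ C : ℝ, 0 < C ∧
      ∀ (α δ : ℝ), α ∈ Set.Ioo (0 : ℝ) 1 → δ ∈ Set.Ioo (0 : ℝ) 1 →
        ∀ d m n r : ℕ, 2 ≤ r → α < 1 / ((r : ℝ) ^ 2 + r) → 1 ≤ m →
          (m : ℝ) ≤ (1 - δ) * (n.choose 2 : ℝ) →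
          prGnm n m (fun G => ¬ InCORE d r α G) ≤
            C * (r : ℝ) ^ 2 / α *
              ((((d : ℝ) + 1) / δ + r) * Real.sqrt ((n : ℝ) / m) +
                ((n : ℝ) / m) ^ ((1 : ℝ) / 4)) := by
  refine ⟨400, by norm_num, ?_⟩
  rintro α δ ⟨hα0, hα1⟩ ⟨hδ0, hδ1⟩ d m n r hr hα hm hmδ
  rw [← card_edgeType] at hmδ
  have hm0 : (0 : ℝ) < m := by exact_mod_cast hm
  have hr2 : (2 : ℝ) ≤ r := by exact_mod_cast hr
  have hn2 : 2 ≤ n := by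
    by_contra! h
    have h0 : Fintype.card (EdgeType n) = 0 := by
      rw [card_edgeType, Nat.choose_eq_zero_of_lt h]
    rw [h0, Nat.cast_zero, mul_zero] at hmδ
    linarith
  have hn0 : (0 : ℝ) < n := by exact_mod_cast (by omega : 0 < n)
  set q : ℝ := ((n : ℝ) / m) ^ ((1 : ℝ) / 4) with hq
  set s : ℝ := Real.sqrt ((n : ℝ) / m) with hs
  set A : ℝ := ((d : ℝ) + 1) / δ with hA
  have hs0 : 0 < s := Real.sqrt_pos.2 (by positivity)
  have hq0 : 0 < q := Real.rpow_pos_of_pos (by positivity) _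
  have hqs : q ^ 2 = s := by
    rw [hq, hs, Real.sqrt_eq_rpow, ← Real.rpow_natCast, ← Real.rpow_mul (by positivity)]
    norm_num
  clear_value q s
  have hd0 : (0 : ℝ) ≤ d := by positivity
  have hA1 : 1 ≤ A := by
    rw [hA, le_div_iff₀ hδ0]; linarith
  clear_value A
  have hA0 : 0 < A := by linarith
  have hα4 : 1 ≤ (r : ℝ) ^ 2 / α := by
    rw [le_div_iff₀ hα0]; nlinarith
  have hp1 := prGnm_le_one n m (fun G => ¬ InCORE d r α G)
  by_cases hbig : 1 ≤ 400 * (A * s)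
  · have h1 : 400 * (A * s) ≤ 400 * ((r : ℝ) ^ 2 / α) * (A * s) := by
      have : 0 ≤ A * s := by positivity
      nlinarith
    have h2 : 0 ≤ 400 * ((r : ℝ) ^ 2 / α) * (r * s + q) := by positivity
    calc _ ≤ 400 * ((r : ℝ) ^ 2 / α) * (A * s) + 400 * ((r : ℝ) ^ 2 / α) * (r * s + q) := by
          linarith
      _ = _ := by ring
  rw [not_le] at hbig
  have hs1 : s < 1 := by nlinarith
  have hnm' : (n : ℝ) < m := by
    rw [hs, Real.sqrt_lt' one_pos, one_pow, div_lt_one hm0] at hs1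
    exact hs1
  have hnm : n ≤ m := by exact_mod_cast hnm'.le
  set N : ℝ := (Fintype.card (EdgeType n) : ℝ) with hN
  have hsN : 1 ≤ s * N := by
    have h1 : (n : ℝ) / m ≤ s := by
      have h2 : s ^ 2 = n / m := by rw [hs]; exact Real.sq_sqrt (by positivity)
      rw [← h2]; nlinarith
    have h3 : (m : ℝ) ≤ N := hmδ.trans (by nlinarith [(by positivity : 0 ≤ N)])
    have h4 : (n : ℝ) / m * m = n := by field_simp
    have h5 : (2 : ℝ) ≤ n := by exact_mod_cast hn2
    calc (1 : ℝ) ≤ (n : ℝ) / m * m := by linarith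
      _ ≤ s * N := by gcongr
  have hdN : (d : ℝ) + 1 ≤ δ / 2 * N := by
    have h1 : ((d : ℝ) + 1) = δ * A := by rw [hA]; field_simp
    have h2 : A ≤ A * (s * N) := le_mul_of_one_le_right (by linarith) hsN
    have h3 : 400 * (A * s) * N ≤ 1 * N := by gcongr
    have h4 : A ≤ N / 2 := by linarith [(by positivity : 0 ≤ N)]
    rw [h1]
    nlinarith
  have hmd : m + d + 1 ≤ Fintype.card (EdgeType n) := by
    have : ((m + d + 1 : ℕ) : ℝ) ≤ N := by
      push_cast
      nlinarith [(by positivity : 0 ≤ N)]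
    rw [hN] at this
    exact_mod_cast this
  have hmain := prGnm_not_inCORE_le (d := d) hr (by omega) hnm hα0 hα
    (by linarith : 0 < δ / 2) (by linarith) hmd (by linarith)
  rw [← hs] at hmain
  rw [hA]
  exact le_linear_bound_of_le_one hp1 hα0 hδ0 hr2 hd0 hs0.le hq0.le hqs hmain

end
end

section
/- Let r ≥ 2 and d ≥ 0 be integers and let G and T be graphs on vertex set [n], with T having e_T edges. Then every pair of vertices that is (d + e_T, r)-equivalent in G is (d, r)-equivalent in the symmetric difference G △ T (the graph whose edge set is the symmetric difference of the edge sets of G and T); that is, eq_{d+e_T}^r(G) ⊆ eq_d^r(G △ T). -/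
open scoped Classical

noncomputable section

/-- The set of pairs of `(d,r)`-equivalent vertices of `G`. -/
def eqPairs {n : ℕ} (d r : ℕ) (G : EdgeSetGraph n) : Finset (EdgeType n) :=
  Finset.univ.filter fun e =>
    ∀ φ : Fin n → Fin r, deficit r φ G ≤ d → (Sym2.map φ (e : Sym2 (Fin n))).IsDiag

theorem cutSize_eq_card_filter {n r : ℕ} (φ : Fin n → Fin r) (G : EdgeSetGraph n) :
    cutSize φ G = (Finset.filter (fun e : EdgeType n => ¬ (Sym2.map φ e.1).IsDiag) G).card := by
  rw [← Finset.card_map (Function.Embedding.subtype _)]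
  unfold cutSize
  congr 1
  ext x
  simp only [Finset.mem_filter, Finset.mem_map, Function.Embedding.subtype_apply,
    Finset.bind_def, Finset.pure_def, Finset.mem_sup, Finset.mem_singleton]
  grind

theorem cutSize_le_add_card {n r : ℕ} (φ : Fin n → Fin r) {G H S : EdgeSetGraph n}
    (h : G ⊆ H ∪ S) : cutSize φ G ≤ cutSize φ H + S.card := by
  rw [cutSize_eq_card_filter, cutSize_eq_card_filter]
  refine (Finset.card_le_card (Finset.filter_subset_filter _ h)).trans ?_
  rw [Finset.filter_union]
  exact (Finset.card_union_le _ _).trans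
    (Nat.add_le_add_left (Finset.card_filter_le _ _) _)

theorem cutSize_le_maxCut {n r : ℕ} (φ : Fin n → Fin r) (G : EdgeSetGraph n) :
    cutSize φ G ≤ maxCut n r G :=
  Finset.le_sup (f := fun φ : Fin n → Fin r => cutSize φ G) (Finset.mem_univ φ)

theorem maxCut_le_add_card {n : ℕ} (r : ℕ) {G H S : EdgeSetGraph n} (h : G ⊆ H ∪ S) :
    maxCut n r G ≤ maxCut n r H + S.card :=
  Finset.sup_le fun φ _ => (cutSize_le_add_card φ h).trans
    (Nat.add_le_add_right (cutSize_le_maxCut φ H) _)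

theorem deficit_le_deficit_symmDiff_add_card {n r : ℕ} (φ : Fin n → Fin r)
    (G T : EdgeSetGraph n) :
    deficit r φ G ≤ deficit r φ (symmDiff G T) + T.card := by
  have hmax : maxCut n r G ≤ maxCut n r (symmDiff G T) + (T ∩ G).card := by
    apply maxCut_le_add_card
    intro e he
    simp only [Finset.mem_union, Finset.mem_symmDiff, Finset.mem_inter]
    tauto
  have hcut : cutSize φ (symmDiff G T) ≤ cutSize φ G + (T \ G).card := by
    apply cutSize_le_add_card
    intro e he
    simp only [Finset.mem_union, Finset.mem_symmDiff, Finset.mem_sdiff] at he ⊢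
    tauto
  have hcard := Finset.card_inter_add_card_sdiff T G
  unfold deficit
  omega

/-- Every pair of vertices that is `(d + e_T, r)`-equivalent in `G` is `(d,r)`-equivalent in
the symmetric difference `G △ T`. -/
theorem eqPairs_symmDiff_subset
    (n r d : ℕ) (hr : 2 ≤ r) (G T : EdgeSetGraph n) :
    eqPairs (d + T.card) r G ⊆ eqPairs d r (symmDiff G T) := by
  intro e he
  simp only [eqPairs, Finset.mem_filter, Finset.mem_univ, true_and] at he ⊢
  exact fun φ hφ => he φ <|
    (deficit_le_deficit_symmDiff_add_card φ G T).trans (Nat.add_le_add_right hφ _)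

end
end
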